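/- arXiv:2407.04931 — 2 statements merged into one kernel-verified Lean document; each statement's English description precedes it below -/
import Mathlib

section
/- Let g > 0 and let (μ_t)_{t ≥ 0} be a family of probability measures on the extended half-line [0,∞] such that: (a) for every a > 0 the map t ↦ μ_t([a,∞]) is nondecreasing and continuous on [0,∞); and (b) for every t ≥ 0, ∫_{[0,∞]} e^{-λx} dμ_t(x) = e^{-t·g}, where λ > 0 is fixed and e^{-λ·∞} is interpreted as 0. Define ℓ(a,b) = inf{t ≥ 0 : μ_t([a,∞]) ≥ b} for a ∈ (0,∞), b ∈ (0,1). If Y and U are independent random variables with Y ~ Exp(λ) and U ~ Uniform(0,1), then ℓ(Y,U) ~ Exp(g); equivalently, ℙ(ℓ(Y,U) ≥ w) = e^{-w·g} for every w > 0. -/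
open MeasureTheory ProbabilityTheory Set
open scoped ENNReal

lemma expMeasure_Ioi {r : ℝ} (hr : 0 < r) {x : ℝ} (hx : 0 ≤ x) :
    expMeasure r (Ioi x) = ENNReal.ofReal (Real.exp (-(r * x))) := by
  have := isProbabilityMeasure_expMeasure hr
  rw [← compl_Iic, prob_compl_eq_one_sub measurableSet_Iic, ← ofReal_cdf,
    cdf_expMeasure_eq hr, if_pos hx, ← ENNReal.ofReal_one,
    ← ENNReal.ofReal_sub _ (by simp; positivity)]
  congr 1
  ring

lemma expMeasure_setOf_lt_ofReal {r : ℝ} (hr : 0 < r) (x : ℝ≥0∞) :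
    expMeasure r {y : ℝ | x < ENNReal.ofReal y} =
      if x = ∞ then 0 else ENNReal.ofReal (Real.exp (-(r * x.toReal))) := by
  split_ifs with hx
  · simp [hx]
  · rw [← expMeasure_Ioi hr ENNReal.toReal_nonneg]
    congr 1
    ext y
    exact ENNReal.lt_ofReal_iff_toReal_lt hx

lemma lintegral_measure_lt_expMeasure {r : ℝ} (hr : 0 < r) (m : Measure ℝ≥0∞) [SFinite m] :
    ∫⁻ y, m {x | x < ENNReal.ofReal y} ∂(expMeasure r) =
      ∫⁻ x, (if x = ∞ then 0 else ENNReal.ofReal (Real.exp (-(r * x.toReal)))) ∂m := by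
  have := isProbabilityMeasure_expMeasure hr
  have hS : MeasurableSet {p : ℝ × ℝ≥0∞ | p.2 < ENNReal.ofReal p.1} :=
    measurableSet_lt measurable_snd (ENNReal.measurable_ofReal.comp measurable_fst)
  simp_rw [← expMeasure_setOf_lt_ofReal hr]
  exact (Measure.prod_apply hS).symm.trans (Measure.prod_apply_symm hS)

lemma volume_restrict_Ioo_setOf_lt_ofReal {c : ℝ≥0∞} (hc : c ≤ 1) :
    (volume.restrict (Ioo (0 : ℝ) 1)) {u | c < ENNReal.ofReal u} = 1 - c := by
  have hc' : c ≠ ∞ := ne_top_of_le_ne_top ENNReal.one_ne_top hc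
  have h : {u : ℝ | c < ENNReal.ofReal u} ∩ Ioo 0 1 = Ioo c.toReal 1 := by
    ext u
    simp only [mem_inter_iff, mem_ofPred_eq, ENNReal.lt_ofReal_iff_toReal_lt hc', mem_Ioo]
    have := c.toReal_nonneg
    grind
  rw [Measure.restrict_apply' measurableSet_Ioo, h, Real.volume_Ioo,
    ENNReal.ofReal_sub _ ENNReal.toReal_nonneg, ENNReal.ofReal_one, ENNReal.ofReal_toReal hc']

lemma volume_restrict_Ioo_setOf_le_ofReal {c : ℝ≥0∞} (hc : c ≤ 1) :
    (volume.restrict (Ioo (0 : ℝ) 1)) {u | c ≤ ENNReal.ofReal u} = 1 - c := by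
  have hc' : c ≠ ∞ := ne_top_of_le_ne_top ENNReal.one_ne_top hc
  rw [← volume_restrict_Ioo_setOf_lt_ofReal hc]
  refine measure_congr ?_
  have hne : ∀ᵐ u ∂(volume.restrict (Ioo (0 : ℝ) 1)), u ≠ c.toReal :=
    ae_restrict_of_ae (Measure.ae_ne volume _)
  filter_upwards [hne, ae_restrict_mem measurableSet_Ioo] with u hu hu'
  refine propext ⟨fun h => lt_of_le_of_ne h fun h' => hu ?_, fun h => le_of_lt h⟩
  rw [h', ENNReal.toReal_ofReal hu'.1.le]

section Tail

variable {m : Measure ℝ≥0∞}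

lemma measurable_measure_ofReal_le : Measurable fun y : ℝ => m {x | ENNReal.ofReal y ≤ x} :=
  Antitone.measurable fun _ _ h =>
    measure_mono fun _ hx => (ENNReal.ofReal_le_ofReal h).trans hx

lemma one_sub_measure_ofReal_le [IsProbabilityMeasure m] (y : ℝ) :
    1 - m {x | ENNReal.ofReal y ≤ x} = m {x | x < ENNReal.ofReal y} := by
  have hS : MeasurableSet {x : ℝ≥0∞ | ENNReal.ofReal y ≤ x} := measurableSet_Ici
  rw [← prob_compl_eq_one_sub hS]
  congr 1
  ext x
  simp

variable {r : ℝ}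

/-- The Chernoff bound for the lower tail. -/
lemma measure_lt_ofReal_le_laplace (hr : 0 < r) (a : ℝ) :
    m {x | x < ENNReal.ofReal a} ≤ ENNReal.ofReal (Real.exp (r * a)) *
      ∫⁻ x, (if x = ∞ then 0 else ENNReal.ofReal (Real.exp (-(r * x.toReal)))) ∂m := by
  have hS : MeasurableSet {x : ℝ≥0∞ | x < ENNReal.ofReal a} := measurableSet_Iio
  rw [← lintegral_const_mul' _ _ ENNReal.ofReal_ne_top, ← lintegral_indicator_one hS]
  refine lintegral_mono fun x => ?_
  by_cases hx : x < ENNReal.ofReal a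
  · have hx' : x ≠ ∞ := hx.ne_top
    have hlt : x.toReal < a := (ENNReal.lt_ofReal_iff_toReal_lt hx').1 hx
    rw [indicator_of_mem (show x ∈ {x : ℝ≥0∞ | x < ENNReal.ofReal a} from hx), if_neg hx',
      ← ENNReal.ofReal_mul (Real.exp_pos _).le, ← Real.exp_add,
      Pi.one_apply, ENNReal.one_le_ofReal, Real.one_le_exp_iff]
    nlinarith
  · simp [indicator_of_notMem (show x ∉ {x : ℝ≥0∞ | x < ENNReal.ofReal a} from hx)]

variable [IsProbabilityMeasure m]

lemma expMeasure_prod_uniform_tail_lt (hr : 0 < r) :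
    ((expMeasure r).prod (volume.restrict (Ioo (0 : ℝ) 1)))
        {p | m {x | ENNReal.ofReal p.1 ≤ x} < ENNReal.ofReal p.2} =
      ∫⁻ x, (if x = ∞ then 0 else ENNReal.ofReal (Real.exp (-(r * x.toReal)))) ∂m := by
  have hS : MeasurableSet {p : ℝ × ℝ | m {x | ENNReal.ofReal p.1 ≤ x} < ENNReal.ofReal p.2} :=
    measurableSet_lt (measurable_measure_ofReal_le.comp measurable_fst)
      (ENNReal.measurable_ofReal.comp measurable_snd)
  rw [Measure.prod_apply hS, ← lintegral_measure_lt_expMeasure hr]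
  refine lintegral_congr fun y => ?_
  rw [← one_sub_measure_ofReal_le]
  exact volume_restrict_Ioo_setOf_lt_ofReal (c := m {x | ENNReal.ofReal y ≤ x}) prob_le_one

lemma expMeasure_prod_uniform_tail_le (hr : 0 < r) :
    ((expMeasure r).prod (volume.restrict (Ioo (0 : ℝ) 1)))
        {p | m {x | ENNReal.ofReal p.1 ≤ x} ≤ ENNReal.ofReal p.2} =
      ∫⁻ x, (if x = ∞ then 0 else ENNReal.ofReal (Real.exp (-(r * x.toReal)))) ∂m := by
  have hS : MeasurableSet {p : ℝ × ℝ | m {x | ENNReal.ofReal p.1 ≤ x} ≤ ENNReal.ofReal p.2} :=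
    measurableSet_le (measurable_measure_ofReal_le.comp measurable_fst)
      (ENNReal.measurable_ofReal.comp measurable_snd)
  rw [Measure.prod_apply hS, ← lintegral_measure_lt_expMeasure hr]
  refine lintegral_congr fun y => ?_
  rw [← one_sub_measure_ofReal_le]
  exact volume_restrict_Ioo_setOf_le_ofReal (c := m {x | ENNReal.ofReal y ≤ x}) prob_le_one

end Tail

section Level

variable {F : ℝ → ℝ≥0∞} {b : ℝ≥0∞} {w : ℝ}

lemma le_sInf_level_of_lt (hF : MonotoneOn F (Ici 0))
    (hne : ∃ t, 0 ≤ t ∧ b ≤ F t) (hw : 0 < w) (h : F w < b) :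
    w ≤ sInf {t : ℝ | 0 ≤ t ∧ b ≤ F t} := by
  refine le_csInf hne fun t ⟨ht, hbt⟩ => le_of_lt ?_
  by_contra! htw
  exact ((hbt.trans (hF ht hw.le htw)).trans_lt h).false

lemma le_of_le_sInf_level (hF : ContinuousOn F (Ici 0)) (hw : 0 < w)
    (h : w ≤ sInf {t : ℝ | 0 ≤ t ∧ b ≤ F t}) : F w ≤ b := by
  have hcont : Filter.Tendsto F (nhdsWithin w (Iio w)) (nhds (F w)) :=
    ((hF.continuousAt (Ici_mem_nhds hw)).tendsto).mono_left nhdsWithin_le_nhds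
  refine le_of_tendsto hcont ?_
  filter_upwards [Ioo_mem_nhdsLT hw] with t ht
  by_contra! hb
  exact (h.trans (csInf_le ⟨0, fun s hs => hs.1⟩ ⟨ht.1.le, hb.le⟩)).not_gt ht.2

end Level

lemma exists_level {g lam : ℝ} (hg : 0 < g) (hlam : 0 < lam)
    {μ : ℝ → Measure ℝ≥0∞} (hprob : ∀ t : ℝ, 0 ≤ t → IsProbabilityMeasure (μ t))
    (hlaplace : ∀ t : ℝ, 0 ≤ t →
      (∫⁻ x, (if x = ∞ then 0 else ENNReal.ofReal (Real.exp (-(lam * x.toReal)))) ∂(μ t))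
        = ENNReal.ofReal (Real.exp (-(t * g))))
    (a : ℝ) {b : ℝ} (hb : b < 1) :
    ∃ t : ℝ, 0 ≤ t ∧ ENNReal.ofReal b ≤ μ t {x : ℝ≥0∞ | ENNReal.ofReal a ≤ x} := by
  have hlim : Filter.Tendsto (fun t : ℝ => Real.exp (lam * a) * Real.exp (-(t * g)))
      Filter.atTop (nhds 0) := by
    rw [← mul_zero (Real.exp (lam * a))]
    exact (Real.tendsto_exp_neg_atTop_nhds_zero.comp
      (Filter.tendsto_id.atTop_mul_const hg)).const_mul _
  obtain ⟨t, ht, ht0⟩ := ((hlim.eventually_lt_const (sub_pos.2 hb)).and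
    (Filter.eventually_ge_atTop 0)).exists
  refine ⟨t, ht0, ?_⟩
  have := hprob t ht0
  have hle := measure_lt_ofReal_le_laplace (m := μ t) hlam a
  rw [hlaplace t ht0, ← ENNReal.ofReal_mul (Real.exp_pos _).le] at hle
  have hle' := hle.trans (ENNReal.ofReal_le_ofReal ht.le)
  rw [← one_sub_measure_ofReal_le, tsub_le_iff_right] at hle'
  rcases le_or_gt b 0 with hb0 | hb0
  · simp [ENNReal.ofReal_of_nonpos hb0]
  · rw [ENNReal.ofReal_sub _ hb0.le, ENNReal.ofReal_one] at hle'
    refine (ENNReal.add_le_add_iff_left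
      (ne_top_of_le_ne_top ENNReal.one_ne_top
        (tsub_le_self : 1 - ENNReal.ofReal b ≤ 1))).1 ?_
    rwa [tsub_add_cancel_of_le (by simpa using hb.le)]

lemma ae_pos_expMeasure {r : ℝ} (hr : 0 < r) : ∀ᵐ y ∂(expMeasure r), 0 < y := by
  have := isProbabilityMeasure_expMeasure hr
  refine (prob_compl_eq_zero_iff measurableSet_Ioi).2 ?_
  simpa using expMeasure_Ioi hr le_rfl

/-- If `(μ t)` is a family of probability measures on `[0,∞]` whose upper-tail
probabilities `t ↦ μ t [a,∞]` are nondecreasing and continuous on `[0,∞)`, and whose Laplace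
transform at the fixed rate `lam` equals `e^{-t g}` (with `e^{-lam·∞} = 0`), then for independent
`Y ~ Exp(lam)` and `U ~ Uniform(0,1)`, the level value
`ℓ(Y,U) = inf {t ≥ 0 : μ t [Y,∞] ≥ U}` satisfies `ℙ(ℓ(Y,U) ≥ w) = e^{-w g}` for all `w > 0`,
i.e. `ℓ(Y,U) ~ Exp(g)`. -/
theorem levy_level_function_G_transformation
    {Ω : Type*} [MeasurableSpace Ω] (P : Measure Ω) [IsProbabilityMeasure P]
    (g lam : ℝ) (hg : 0 < g) (hlam : 0 < lam)
    (μ : ℝ → Measure ℝ≥0∞) (hprob : ∀ t : ℝ, 0 ≤ t → IsProbabilityMeasure (μ t))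
    -- (a): for every a > 0, t ↦ μ_t([a,∞]) is nondecreasing and continuous on [0,∞)
    (hmono : ∀ a : ℝ, 0 < a →
      MonotoneOn (fun t : ℝ => μ t {x : ℝ≥0∞ | ENNReal.ofReal a ≤ x}) (Ici 0))
    (hcont : ∀ a : ℝ, 0 < a →
      ContinuousOn (fun t : ℝ => μ t {x : ℝ≥0∞ | ENNReal.ofReal a ≤ x}) (Ici 0))
    -- (b): Laplace transform condition, with e^{-lam·∞} interpreted as 0
    (hlaplace : ∀ t : ℝ, 0 ≤ t →
      (∫⁻ x, (if x = ∞ then 0 else ENNReal.ofReal (Real.exp (-(lam * x.toReal)))) ∂(μ t))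
        = ENNReal.ofReal (Real.exp (-(t * g))))
    -- the level function ℓ(a,b) = inf {t ≥ 0 : μ_t([a,∞]) ≥ b}
    (ℓ : ℝ → ℝ → ℝ)
    (hℓ : ∀ a b : ℝ, 0 < a → 0 < b → b < 1 →
      ℓ a b = sInf {t : ℝ | 0 ≤ t ∧
        ENNReal.ofReal b ≤ μ t {x : ℝ≥0∞ | ENNReal.ofReal a ≤ x}})
    -- Y ~ Exp(lam), U ~ Uniform(0,1), independent
    (Y U : Ω → ℝ) (hYm : Measurable Y) (hUm : Measurable U)
    (hY : Measure.map Y P = expMeasure lam)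
    (hU : Measure.map U P = volume.restrict (Ioo (0 : ℝ) 1))
    (hind : IndepFun Y U P) :
    ∀ w : ℝ, 0 < w →
      P {ω | w ≤ ℓ (Y ω) (U ω)} = ENNReal.ofReal (Real.exp (-(w * g))) := by
  intro w hw
  have := hprob w hw.le
  have hmap : P.map (fun ω => (Y ω, U ω)) =
      (expMeasure lam).prod (volume.restrict (Ioo (0 : ℝ) 1)) := by
    rw [← hY, ← hU]
    exact (indepFun_iff_map_prod_eq_prod_map_map hYm.aemeasurable hUm.aemeasurable).1 hind
  have hYpos : ∀ᵐ ω ∂P, 0 < Y ω :=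
    ae_of_ae_map hYm.aemeasurable (hY ▸ ae_pos_expMeasure hlam)
  have hUmem : ∀ᵐ ω ∂P, U ω ∈ Ioo (0 : ℝ) 1 :=
    ae_of_ae_map hUm.aemeasurable (hU ▸ ae_restrict_mem measurableSet_Ioo)
  have hF : Measurable fun p : ℝ × ℝ => μ w {x | ENNReal.ofReal p.1 ≤ x} :=
    measurable_measure_ofReal_le.comp measurable_fst
  have hR : Measurable fun p : ℝ × ℝ => ENNReal.ofReal p.2 :=
    ENNReal.measurable_ofReal.comp measurable_snd
  rw [← hlaplace w hw.le]
  apply le_antisymm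
  · rw [← expMeasure_prod_uniform_tail_le (m := μ w) hlam, ← hmap,
      Measure.map_apply (hYm.prodMk hUm) (measurableSet_le hF hR)]
    refine measure_mono_ae ?_
    filter_upwards [hYpos, hUmem] with ω hy hu hω
    change w ≤ ℓ (Y ω) (U ω) at hω
    rw [hℓ _ _ hy hu.1 hu.2] at hω
    exact le_of_le_sInf_level (hcont _ hy) hw hω
  · rw [← expMeasure_prod_uniform_tail_lt (m := μ w) hlam, ← hmap,
      Measure.map_apply (hYm.prodMk hUm) (measurableSet_lt hF hR)]
    refine measure_mono_ae ?_
    filter_upwards [hYpos, hUmem] with ω hy hu hω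
    change w ≤ ℓ (Y ω) (U ω)
    rw [hℓ _ _ hy hu.1 hu.2]
    exact le_sInf_level_of_lt (hmono _ hy)
      (exists_level hg hlam hprob hlaplace _ hu.2) hw hω
end

section
/- For w > 0 and a > 0 define h_a(w) = Γ(w)⁻¹ ∫_a^∞ r^{w−1} e^{−r} dr, the probability that a Gamma(w,1) random variable is at least a, where Γ is the Gamma function. Then for every fixed a > 0, the map w ↦ h_a(w) is strictly increasing on (0,∞). Consequently, for every a > 0 and b ∈ (0,1) there is at most one w > 0 with h_a(w) = b. -/
open Set MeasureTheory

/-- `h_a(w) = Γ(w)⁻¹ ∫_a^∞ r^{w−1} e^{−r} dr`, the probability that a `Gamma(w,1)` random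
variable is at least `a`. -/
noncomputable def gammaTail (a w : ℝ) : ℝ :=
  (Real.Gamma w)⁻¹ * ∫ r in Ioi a, r ^ (w - 1) * Real.exp (-r)

/-- A function that is positive on a set of positive measure has positive integral there. -/
theorem setIntegral_pos_of_forall_pos {X : Type*} [MeasurableSpace X] {μ : Measure X}
    {s : Set X} {f : X → ℝ} (hs : MeasurableSet s) (hμ : 0 < μ s) (hf : IntegrableOn f s μ)
    (hpos : ∀ x ∈ s, 0 < f x) : 0 < ∫ x in s, f x ∂μ := by
  rw [setIntegral_pos_iff_support_of_nonneg_ae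
    ((ae_restrict_iff' hs).2 (ae_of_all _ fun x hx => (hpos x hx).le)) hf]
  rwa [inter_eq_self_of_subset_right fun x hx => Function.mem_support.2 (hpos x hx).ne']

theorem integrableOn_rpow_mul_exp_neg_Ioi {w : ℝ} (hw : 0 < w) :
    IntegrableOn (fun r : ℝ => r ^ (w - 1) * Real.exp (-r)) (Ioi 0) := by
  simpa only [mul_comm] using Real.GammaIntegral_convergent hw

theorem Real.Gamma_eq_integral_Ioc_add_integral_Ioi {a w : ℝ} (ha : 0 ≤ a) (hw : 0 < w) :
    Real.Gamma w = (∫ r in Ioc 0 a, r ^ (w - 1) * Real.exp (-r)) +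
      ∫ r in Ioi a, r ^ (w - 1) * Real.exp (-r) := by
  have hint := integrableOn_rpow_mul_exp_neg_Ioi hw
  rw [← setIntegral_union (Ioc_disjoint_Ioi le_rfl) measurableSet_Ioi
    (hint.mono_set Ioc_subset_Ioi_self) (hint.mono_set (Ioi_subset_Ioi ha)),
    Ioc_union_Ioi_eq_Ioi ha, Real.Gamma_eq_integral hw]
  simp only [mul_comm]

theorem gammaTail_strictMonoOn {a : ℝ} (ha : 0 < a) : StrictMonoOn (gammaTail a) (Ioi 0) := by
  intro s hs t ht hst
  rw [mem_Ioi] at hs ht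
  have his := integrableOn_rpow_mul_exp_neg_Ioi hs
  have hit := integrableOn_rpow_mul_exp_neg_Ioi ht
  have hIoi : Ioi a ⊆ Ioi 0 := Ioi_subset_Ioi ha.le
  have hIoc : Ioc 0 a ⊆ Ioi 0 := Ioc_subset_Ioi_self
  have hpos : ∀ w r : ℝ, 0 < r → 0 < r ^ (w - 1) * Real.exp (-r) := fun w r hr => by positivity
  have hratio : ∀ r : ℝ, 0 < r →
      r ^ (t - 1) * Real.exp (-r) = r ^ (t - s) * (r ^ (s - 1) * Real.exp (-r)) := fun r hr => by
    rw [← mul_assoc, ← Real.rpow_add hr]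
    ring_nf
  have hvol : 0 < volume (Ioi a) := by simp
  have hhead_pos : 0 < ∫ r in Ioc 0 a, r ^ (s - 1) * Real.exp (-r) :=
    setIntegral_pos_of_forall_pos measurableSet_Ioc (by simpa using ha) (his.mono_set hIoc)
      fun r hr => hpos s r hr.1
  have htail_pos : 0 < ∫ r in Ioi a, r ^ (s - 1) * Real.exp (-r) :=
    setIntegral_pos_of_forall_pos measurableSet_Ioi hvol (his.mono_set hIoi)
      fun r hr => hpos s r (hIoi hr)
  have hhead : ∫ r in Ioc 0 a, r ^ (t - 1) * Real.exp (-r) ≤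
      a ^ (t - s) * ∫ r in Ioc 0 a, r ^ (s - 1) * Real.exp (-r) := by
    rw [← integral_const_mul]
    refine setIntegral_mono_on (hit.mono_set hIoc) ((his.mono_set hIoc).const_mul _)
      measurableSet_Ioc fun r hr => ?_
    rw [hratio r hr.1]
    exact mul_le_mul_of_nonneg_right (Real.rpow_le_rpow hr.1.le hr.2 (sub_pos.2 hst).le)
      (hpos s r hr.1).le
  have htail : a ^ (t - s) * ∫ r in Ioi a, r ^ (s - 1) * Real.exp (-r) <
      ∫ r in Ioi a, r ^ (t - 1) * Real.exp (-r) := by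
    rw [← integral_const_mul, ← sub_pos,
      ← integral_sub (hit.mono_set hIoi) ((his.mono_set hIoi).const_mul _)]
    refine setIntegral_pos_of_forall_pos measurableSet_Ioi hvol
      ((hit.mono_set hIoi).sub ((his.mono_set hIoi).const_mul _)) fun r hr => ?_
    rw [hratio r (hIoi hr), sub_pos]
    exact mul_lt_mul_of_pos_right (Real.rpow_lt_rpow ha.le hr (sub_pos.2 hst))
      (hpos s r (hIoi hr))
  rw [gammaTail, gammaTail, inv_mul_eq_div, inv_mul_eq_div,
    div_lt_div_iff₀ (Real.Gamma_pos_of_pos hs) (Real.Gamma_pos_of_pos ht),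
    Real.Gamma_eq_integral_Ioc_add_integral_Ioi ha.le hs,
    Real.Gamma_eq_integral_Ioc_add_integral_Ioi ha.le ht]
  linarith [mul_le_mul_of_nonneg_left hhead htail_pos.le, mul_lt_mul_of_pos_left htail hhead_pos]

/-- For every fixed `a > 0`, the map `w ↦ h_a(w)` is strictly increasing on
`(0,∞)`; consequently for every `b ∈ (0,1)` there is at most one `w > 0` with `h_a(w) = b`. -/
theorem gamma_tail_strictMono_in_shape (a : ℝ) (ha : 0 < a) :
    StrictMonoOn (gammaTail a) (Ioi 0) ∧
    ∀ b : ℝ, 0 < b → b < 1 → ∀ w₁ w₂ : ℝ, 0 < w₁ → 0 < w₂ →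
      gammaTail a w₁ = b → gammaTail a w₂ = b → w₁ = w₂ := by
  exact ⟨gammaTail_strictMonoOn ha, fun b _ _ w₁ w₂ h₁ h₂ hb₁ hb₂ =>
    (gammaTail_strictMonoOn ha).injOn h₁ h₂ (hb₁.trans hb₂.symm)⟩
end
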